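/- Let Φ be the map assigning to each f : ℕ → ℕ with f(n) > 0 for n ≥ 1 the density ideal Φ(f) = Exh(sup_{n≥1} μ_n^f), where (I_n)_{n≥1} is the consecutive interval partition of ℕ with min I_1 = 0 and |I_n| = n·f(n), and μ_n^f assigns mass 1/f(n) to every point of I_n (so ‖μ_n^f‖ = n and at⁺(μ_n^f) = at⁻(μ_n^f) = 1/f(n)). Then: (1) for every ideal I ∈ AN there exists f : ℕ → ℕ such that I ≤_K Φ(f); and (2) for all g, h : ℕ → ℕ (positive on n ≥ 1), if 2n²·g(n) ≤ h(n) for all but finitely many n, then Φ(g) ≤_K Φ(h). -/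

import Mathlib

open Filter Topology Set MeasureTheory
open scoped ENNReal NNReal

noncomputable section

/-- The space `N_F = ℕ ∪ {p_F}`, modelled as `Option ℕ` with `none` playing the role of `p_F`:
every natural number (i.e. `some n`) is isolated, and a set containing `none` is open iff its
trace on `ℕ` belongs to `F`. -/
def NFTop (F : Filter ℕ) : TopologicalSpace (Option ℕ) where
  IsOpen U := none ∈ U → {n : ℕ | some n ∈ U} ∈ F
  isOpen_univ := fun _ => Filter.univ_mem
  isOpen_inter := fun U V hU hV h => Filter.inter_mem (hU h.1) (hV h.2)
  isOpen_sUnion := fun S hS h => by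
    obtain ⟨U, hUS, hU⟩ := h
    exact Filter.mem_of_superset (hS U hUS hU) fun n hn => ⟨U, hUS, hn⟩

/-- A finitely supported signed measure on `N_F` is modelled as a finitely supported
function `Option ℕ →₀ ℝ`; its value on a set `A` is the sum of its weights on `A`. -/
def fsMeas (μ : Option ℕ →₀ ℝ) (A : Set (Option ℕ)) : ℝ :=
  ∑ x ∈ μ.support, A.indicator (fun y => μ y) x

/-- The norm `‖μ‖ = Σ |α_i|` of a finitely supported signed measure. -/
def fsNorm (μ : Option ℕ →₀ ℝ) : ℝ :=
  ∑ x ∈ μ.support, |μ x|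

/-- `‖μ ↾ B‖`, the variation of `μ` on a set `B`. -/
def fsRestrNorm (μ : Option ℕ →₀ ℝ) (B : Set (Option ℕ)) : ℝ :=
  ∑ x ∈ μ.support, B.indicator (fun y => |μ y|) x

/-- The integral `∫ f dμ` of a function against a finitely supported signed measure. -/
def fsInteg (μ : Option ℕ →₀ ℝ) (f : Option ℕ → ℝ) : ℝ :=
  ∑ x ∈ μ.support, μ x * f x

/-- An anti-Nikodym sequence on `N_F`: `‖μ_n‖ → ∞` and `μ_n(A) → 0` for every clopen `A`. -/
def IsANSeq (F : Filter ℕ) (μ : ℕ → (Option ℕ →₀ ℝ)) : Prop :=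
  Tendsto (fun n => fsNorm (μ n)) atTop atTop ∧
    ∀ A : Set (Option ℕ), @IsClopen _ (NFTop F) A →
      Tendsto (fun n => fsMeas (μ n) A) atTop (nhds 0)

/-- A free filter `F` has the Nikodym property if there is no anti-Nikodym sequence on `N_F`. -/
def HasNikodymProp (F : Filter ℕ) : Prop :=
  ¬ ∃ μ : ℕ → (Option ℕ →₀ ℝ), IsANSeq F μ

/-- A finitely supported (nonnegative) measure on `ℕ`, evaluated on a set `A ⊆ ℕ`. -/
def natMeas (μ : ℕ →₀ ℝ) (A : Set ℕ) : ℝ :=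
  ∑ x ∈ μ.support, A.indicator (fun y => μ y) x

/-- The norm of a finitely supported measure on `ℕ`. -/
def natNorm (μ : ℕ →₀ ℝ) : ℝ :=
  ∑ x ∈ μ.support, |μ x|

/-- `at⁺(μ)`: the largest atom of a finitely supported measure on `ℕ`. -/
def atPlus (μ : ℕ →₀ ℝ) : ℝ := sSup ((fun x => μ x) '' ↑μ.support)

/-- `at⁻(μ)`: the smallest atom of a finitely supported measure on `ℕ`. -/
def atMinus (μ : ℕ →₀ ℝ) : ℝ := sInf ((fun x => μ x) '' ↑μ.support)

/-- A submeasure on `ω`. -/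
structure Submeasure where
  toFun : Set ℕ → ℝ≥0∞
  empty' : toFun ∅ = 0
  finite_singleton' : ∀ n : ℕ, toFun {n} ≠ ⊤
  mono' : ∀ ⦃A B : Set ℕ⦄, A ⊆ B → toFun A ≤ toFun B
  subadd' : ∀ A B : Set ℕ, toFun (A ∪ B) ≤ toFun A + toFun B

/-- Lower semicontinuity of a submeasure: `φ(A) = lim_n φ(A ∩ [0,n])`. -/
def Submeasure.LSC (φ : Submeasure) : Prop :=
  ∀ A : Set ℕ, Tendsto (fun n : ℕ => φ.toFun (A ∩ Set.Iic n)) atTop (nhds (φ.toFun A))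

/-- The exhaustive ideal `Exh(φ) = {A : lim_n φ(A ∖ [0,n]) = 0}` of a submeasure. -/
def Exh (φ : Submeasure) : Set (Set ℕ) :=
  {A : Set ℕ | Tendsto (fun n : ℕ => φ.toFun (A \ Set.Iic n)) atTop (nhds 0)}

/-- A density submeasure: `φ = sup_n μ_n` for a sequence of finitely supported nonnegative
measures on `ℕ` with pairwise disjoint supports. -/
def Submeasure.IsDensity (φ : Submeasure) : Prop :=
  ∃ μ : ℕ → (ℕ →₀ ℝ), (∀ n x, 0 ≤ μ n x) ∧
    (∀ m n, m ≠ n → Disjoint (μ m).support (μ n).support) ∧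
    ∀ A : Set ℕ, φ.toFun A = ⨆ n : ℕ, ENNReal.ofReal (natMeas (μ n) A)

/-- A non-pathological submeasure: `φ(A)` is the supremum of `μ(A)` over all nonnegative
(σ-additive) measures `μ` on `ℕ` dominated by `φ`. -/
def Submeasure.Nonpathological (φ : Submeasure) : Prop :=
  ∀ A : Set ℕ,
    φ.toFun A =
      ⨆ (w : ℕ → ℝ≥0∞) (_ : ∀ B : Set ℕ, ∑' n : B, w n ≤ φ.toFun B), ∑' n : A, w n

/-- An ideal on `ω`: contains all finite sets, closed under subsets and finite unions,
and does not contain `ℕ` itself. -/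
def IsIdeal (I : Set (Set ℕ)) : Prop :=
  (∀ A : Set ℕ, A.Finite → A ∈ I) ∧
    (∀ A B : Set ℕ, A ⊆ B → B ∈ I → A ∈ I) ∧
    (∀ A B : Set ℕ, A ∈ I → B ∈ I → A ∪ B ∈ I) ∧
    Set.univ ∉ I

/-- The Katětov order on families of subsets of `ℕ`. -/
def KatLE (I J : Set (Set ℕ)) : Prop :=
  ∃ f : ℕ → ℕ, ∀ A ∈ I, f ⁻¹' A ∈ J

/-- The dual filter `I*` of an ideal `I` (as a `Filter`; when `I` is an ideal, this filter's
sets are exactly the complements of members of `I`). -/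
def dualFilter (I : Set (Set ℕ)) : Filter ℕ :=
  Filter.generate {A : Set ℕ | Aᶜ ∈ I}

/-- The class `AN` of all ideals on `ω` whose dual filters do not have the Nikodym property. -/
def ANclass : Set (Set (Set ℕ)) :=
  {I | IsIdeal I ∧ ¬ HasNikodymProp (dualFilter I)}

/-- A density ideal: `Exh(sup_n μ_n)` for a disjointly supported sequence of finitely
supported nonnegative measures on `ℕ`. -/
def IsDensityIdeal (I : Set (Set ℕ)) : Prop :=
  ∃ μ : ℕ → (ℕ →₀ ℝ), (∀ n x, 0 ≤ μ n x) ∧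
    (∀ m n, m ≠ n → Disjoint (μ m).support (μ n).support) ∧
    I = {A : Set ℕ |
      Tendsto (fun m : ℕ => ⨆ n : ℕ, ENNReal.ofReal (natMeas (μ n) (A \ Set.Iic m)))
        atTop (nhds 0)}

/-- The asymptotic density submeasure `φ_d(A) = sup_n |A ∩ [2^n, 2^{n+1})|/2^n`. -/
def phid (A : Set ℕ) : ℝ≥0∞ :=
  ⨆ n : ℕ, ((A ∩ Set.Ico (2 ^ n) (2 ^ (n + 1))).ncard : ℝ≥0∞) / 2 ^ n

/-- The asymptotic density zero ideal `Z = Exh(φ_d)`. -/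
def Zideal : Set (Set ℕ) :=
  {A : Set ℕ | Tendsto (fun m : ℕ => phid (A \ Set.Iic m)) atTop (nhds 0)}

/-- `Exh(sup_{n ≥ 1} ν_n)` for a sequence of finitely supported measures indexed by `n ≥ 1`. -/
def ExhSupPos (ν : ℕ → (ℕ →₀ ℝ)) : Set (Set ℕ) :=
  {A : Set ℕ |
    Tendsto (fun m : ℕ => ⨆ n : ℕ, ENNReal.ofReal (natMeas (ν (n + 1)) (A \ Set.Iic m)))
      atTop (nhds 0)}

/-- `PhiStart f n` is the left endpoint of the interval `I_n` in the interval partition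
associated with `f` (so `I_n = [PhiStart f n, PhiStart f (n+1))` has `n·f(n)` elements). -/
def PhiStart (f : ℕ → ℕ) (n : ℕ) : ℕ :=
  ∑ k ∈ Finset.range n, k * f k

/-- The density ideal `Φ(f) = Exh(sup_{n≥1} μ_n^f)`, where `μ_n^f` gives mass `1/f(n)` to each
point of the interval `I_n` (of size `n·f(n)`), so that `‖μ_n^f‖ = n`. -/
def PhiIdeal (f : ℕ → ℕ) : Set (Set ℕ) :=
  {A : Set ℕ |
    Tendsto (fun m : ℕ => ⨆ n : ℕ,
        ENNReal.ofReal
          (((A \ Set.Iic m) ∩ Set.Ico (PhiStart f (n + 1)) (PhiStart f (n + 2))).ncard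
            / f (n + 1)))
      atTop (nhds 0)}

/-- The dominating number `𝔡`. -/
def domNumber : Cardinal :=
  sInf {c : Cardinal | ∃ D : Set (ℕ → ℕ), Cardinal.mk D = c ∧
    ∀ g : ℕ → ℕ, ∃ f ∈ D, ∀ᶠ n in atTop, g n ≤ f n}

/-- The unbounding number `𝔟`. -/
def unbNumber : Cardinal :=
  sInf {c : Cardinal | ∃ U : Set (ℕ → ℕ), Cardinal.mk U = c ∧
    ∀ g : ℕ → ℕ, ∃ f ∈ U, {n : ℕ | g n < f n}.Infinite}

/-- A P-ideal: every countable family in `J` has a pseudo-union in `J`. -/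
def IsPIdeal (J : Set (Set ℕ)) : Prop :=
  ∀ A : ℕ → Set ℕ, (∀ n, A n ∈ J) → ∃ B ∈ J, ∀ n, (A n \ B).Finite

/-- The characteristic-function embedding of `P(ℕ)` into the Cantor space `2^ℕ`. -/
def chi (A : Set ℕ) : ℕ → Bool :=
  fun n => @decide (n ∈ A) (Classical.propDecidable _)

end

/-- A sequence of finitely supported signed measures which is null on every set is null in
norm. -/
lemma tendsto_sum_abs_of_tendsto_sum_indicator {ι : Type*} (a : ℕ → (ι →₀ ℝ))
    (h : ∀ B : Set ι, Tendsto (fun n => ∑ x ∈ (a n).support, B.indicator (a n) x) atTop (𝓝 0)) :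
    Tendsto (fun n => ∑ x ∈ (a n).support, |a n x|) atTop (𝓝 0) := by
  classical
  have hpt (x : ι) : Tendsto (fun n => |a n x|) atTop (𝓝 0) := by
    have h0 : Tendsto (fun n => a n x) atTop (𝓝 0) := by
      refine (h {x}).congr fun n => ?_
      by_cases hx : x ∈ (a n).support
      · rw [Finset.sum_eq_single_of_mem x hx] <;> simp +contextual [Set.indicator]
      · rw [Finset.sum_eq_zero]
        · simpa using (Finsupp.notMem_support_iff.1 hx).symm
        · intro y hy
          rw [Set.indicator_of_notMem]
          rintro rfl
          exact hx hy
    simpa using h0.abs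
  rw [Metric.tendsto_atTop]
  intro ε hε
  let m (n : ℕ) (B : ι → Bool) : ℝ := ∑ x ∈ (a n).support, if B x then a n x else 0
  have hm (B : ι → Bool) : Tendsto (fun n => m n B) atTop (𝓝 0) := by
    refine (h {x | B x}).congr fun n => Finset.sum_congr rfl fun x _ => ?_
    by_cases hx : B x = true <;> simp [hx]
  have hcont (n : ℕ) : Continuous (m n) := by
    refine continuous_finsetSum _ fun x _ => ?_
    exact (continuous_of_discreteTopology (f := fun b : Bool => if b then a n x else 0)).comp
      (continuous_apply x)
  let F (k : ℕ) : Set (ι → Bool) := {B | ∀ n, k ≤ n → |m n B| ≤ ε / 16}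
  have hF (k : ℕ) : IsClosed (F k) := by
    simp only [F, Set.ofPred_forall]
    exact isClosed_iInter fun n => isClosed_iInter fun _ =>
      isClosed_le (hcont n).abs continuous_const
  have hU : ⋃ k, F k = univ := by
    refine Set.eq_univ_of_forall fun B => ?_
    obtain ⟨N, hN⟩ := Metric.tendsto_atTop.1 (hm B) (ε / 16) (by positivity)
    refine Set.mem_iUnion.2 ⟨N, fun n hn => ?_⟩
    have := hN n hn
    rw [Real.dist_eq, sub_zero] at this
    exact this.le
  obtain ⟨k, s, hs⟩ := nonempty_interior_of_iUnion_of_closed hF hU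
  obtain ⟨K, u, hu, hK⟩ := isOpen_pi_iff.1 isOpen_interior s hs
  have hcyl (B : ι → Bool) (hB : ∀ x ∈ K, B x = s x) : B ∈ F k :=
    interior_subset (hK fun x hx => by rw [hB x hx]; exact (hu x hx).2)
  have hdiff (C : ι → Bool) (n : ℕ) (hn : k ≤ n) :
      |∑ x ∈ (a n).support, if x ∉ K ∧ C x then a n x else 0| ≤ ε / 8 := by
    have h1 := hcyl (fun x => if x ∈ K then s x else C x) (by simp +contextual) n hn
    have h2 := hcyl (fun x => if x ∈ K then s x else false) (by simp +contextual) n hn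
    have h3 : (∑ x ∈ (a n).support, if x ∉ K ∧ C x then a n x else 0) =
        m n (fun x => if x ∈ K then s x else C x) -
          m n (fun x => if x ∈ K then s x else false) := by
      simp only [m, ← Finset.sum_sub_distrib]
      refine Finset.sum_congr rfl fun x _ => ?_
      by_cases hx : x ∈ K <;> simp [hx]
    rw [h3]
    exact (abs_sub _ _).trans (by linarith)
  have hout (n : ℕ) (hn : k ≤ n) :
      ∑ x ∈ (a n).support, (if x ∉ K then |a n x| else 0) ≤ ε / 4 := by
    have h1 := (abs_le.1 (hdiff (fun x => decide (0 ≤ a n x)) n hn)).2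
    have h2 := (abs_le.1 (hdiff (fun x => decide (a n x < 0)) n hn)).1
    have h3 : ∑ x ∈ (a n).support, (if x ∉ K then |a n x| else 0) =
        (∑ x ∈ (a n).support, if x ∉ K ∧ decide (0 ≤ a n x) = true then a n x else 0) -
          ∑ x ∈ (a n).support, if x ∉ K ∧ decide (a n x < 0) = true then a n x else 0 := by
      rw [← Finset.sum_sub_distrib]
      refine Finset.sum_congr rfl fun x _ => ?_
      by_cases hx : x ∈ K
      · simp [hx]
      · rcases le_or_gt 0 (a n x) with h0 | h0
        · simp [hx, h0, abs_of_nonneg h0, not_lt.2 h0]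
        · simp [hx, h0, abs_of_neg h0, not_le.2 h0]
    rw [h3]
    linarith
  have hin : Tendsto (fun n => ∑ x ∈ K, |a n x|) atTop (𝓝 0) := by
    simpa using tendsto_finsetSum K fun x _ => hpt x
  obtain ⟨N, hN⟩ := Metric.tendsto_atTop.1 hin (ε / 4) (by positivity)
  refine ⟨max N k, fun n hn => ?_⟩
  have h1 := hN n (le_of_max_le_left hn)
  have h2 := hout n (le_of_max_le_right hn)
  rw [Real.dist_eq, sub_zero] at h1 ⊢
  rw [abs_of_nonneg (by positivity)] at h1 ⊢
  have h3 : ∑ x ∈ (a n).support, |a n x| =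
      ∑ x ∈ (a n).support, (if x ∈ K then |a n x| else 0) +
        ∑ x ∈ (a n).support, (if x ∉ K then |a n x| else 0) := by
    rw [← Finset.sum_add_distrib]
    refine Finset.sum_congr rfl fun x _ => ?_
    by_cases hx : x ∈ K <;> simp [hx]
  have h4 : ∑ x ∈ (a n).support, (if x ∈ K then |a n x| else 0) ≤ ∑ x ∈ K, |a n x| := by
    rw [← Finset.sum_filter]
    exact Finset.sum_le_sum_of_subset_of_nonneg (fun x hx => (Finset.mem_filter.1 hx).2)
      fun _ _ _ => abs_nonneg _
  linarith

lemma PhiStart_succ (f : ℕ → ℕ) (n : ℕ) : PhiStart f (n + 1) = PhiStart f n + n * f n :=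
  Finset.sum_range_succ _ _

lemma monotone_PhiStart (f : ℕ → ℕ) : Monotone (PhiStart f) :=
  monotone_nat_of_le_succ fun n => by rw [PhiStart_succ]; exact Nat.le_add_right _ _

lemma le_PhiStart_succ {f : ℕ → ℕ} (hf : ∀ n, 1 ≤ n → 0 < f n) (n : ℕ) :
    n ≤ PhiStart f (n + 1) := by
  rw [PhiStart_succ]
  rcases Nat.eq_zero_or_pos n with rfl | hn
  · simp
  · exact (Nat.le_mul_of_pos_right n (hf n hn)).trans (Nat.le_add_left _ _)

lemma finite_inter_block (f : ℕ → ℕ) (A : Set ℕ) (n : ℕ) :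
    (A ∩ Set.Ico (PhiStart f n) (PhiStart f (n + 1))).Finite :=
  (Set.finite_Ico _ _).inter_of_right _

lemma mem_PhiIdeal_of_tendsto {f : ℕ → ℕ} {A : Set ℕ}
    (h : Tendsto (fun n => ((A ∩ Set.Ico (PhiStart f n) (PhiStart f (n + 1))).ncard : ℝ) / f n)
      atTop (𝓝 0)) : A ∈ PhiIdeal f := by
  have h' := ENNReal.tendsto_ofReal (h.comp (tendsto_add_atTop_nat 1))
  rw [ENNReal.ofReal_zero, ENNReal.tendsto_nhds_zero] at h'
  refine ENNReal.tendsto_nhds_zero.2 fun ε hε => ?_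
  obtain ⟨N, hN⟩ := eventually_atTop.1 (h' ε hε)
  filter_upwards [eventually_ge_atTop (PhiStart f (N + 1))] with m hm
  refine iSup_le fun n => ?_
  rcases lt_or_ge n N with hn | hn
  · have : (A \ Set.Iic m) ∩ Set.Ico (PhiStart f (n + 1)) (PhiStart f (n + 2)) = ∅ := by
      ext x
      simp only [Set.mem_inter_iff, Set.mem_sdiff, Set.mem_Iic, Set.mem_Ico,
        Set.mem_empty_iff_false, iff_false]
      have := monotone_PhiStart f (show n + 2 ≤ N + 1 by omega)
      omega
    simp [this]
  · refine le_trans (ENNReal.ofReal_le_ofReal ?_) (hN n hn)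
    have := Set.ncard_le_ncard (Set.inter_subset_inter_left
      (Set.Ico (PhiStart f (n + 1)) (PhiStart f (n + 2))) (Set.sdiff_subset (s := A)
        (t := Set.Iic m))) (finite_inter_block f A (n + 1))
    simp only [Function.comp]
    gcongr

lemma tendsto_of_mem_PhiIdeal {f : ℕ → ℕ} (hf : ∀ n, 1 ≤ n → 0 < f n) {A : Set ℕ}
    (hA : A ∈ PhiIdeal f) :
    Tendsto (fun n => ((A ∩ Set.Ico (PhiStart f n) (PhiStart f (n + 1))).ncard : ℝ) / f n)
      atTop (𝓝 0) := by
  rw [← tendsto_add_atTop_iff_nat 1, Metric.tendsto_atTop]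
  intro ε hε
  obtain ⟨m, hm⟩ := (ENNReal.tendsto_nhds_zero.1 hA (ENNReal.ofReal (ε / 2))
    (by simpa using hε)).exists
  refine ⟨m + 1, fun n hn => ?_⟩
  have h1 := (le_iSup _ n).trans hm
  rw [ENNReal.ofReal_le_ofReal_iff (by positivity)] at h1
  have h2 : (A \ Set.Iic m) ∩ Set.Ico (PhiStart f (n + 1)) (PhiStart f (n + 2)) =
      A ∩ Set.Ico (PhiStart f (n + 1)) (PhiStart f (n + 2)) := by
    ext x
    simp only [Set.mem_inter_iff, Set.mem_sdiff, Set.mem_Iic, Set.mem_Ico]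
    have := le_PhiStart_succ hf n
    constructor
    · tauto
    · rintro ⟨hx, hx1, hx2⟩
      exact ⟨⟨hx, by omega⟩, hx1, hx2⟩
  rw [h2] at h1
  rw [Real.dist_eq, sub_zero, abs_of_nonneg (by positivity)]
  exact h1.trans_lt (by linarith)

/-- Maps given separately on each block can be glued to a single map. -/
lemma exists_glue_blocks (f : ℕ → ℕ) (φ : ℕ → ℕ → ℕ) :
    ∃ F : ℕ → ℕ, ∀ n i, i < n * f n → F (PhiStart f n + i) = φ n i := by
  classical
  let idx (x : ℕ) : ℕ := sInf {n | x < PhiStart f (n + 1)}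
  refine ⟨fun x => φ (idx x) (x - PhiStart f (idx x)), fun n i hi => ?_⟩
  have hidx : idx (PhiStart f n + i) = n := by
    have hmem : n ∈ {k | PhiStart f n + i < PhiStart f (k + 1)} := by
      simp only [Set.mem_ofPred_eq, PhiStart_succ]
      omega
    refine le_antisymm (Nat.sInf_le hmem) (not_lt.1 fun hlt => ?_)
    have h1 : PhiStart f n + i < PhiStart f (idx (PhiStart f n + i) + 1) :=
      Nat.sInf_mem ⟨n, hmem⟩
    have h2 := monotone_PhiStart f (Nat.succ_le_of_lt hlt)
    rw [Nat.succ_eq_add_one] at h2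
    omega
  simp [hidx]

lemma katLE_PhiIdeal {I : Set (Set ℕ)} {f : ℕ → ℕ} (φ : ℕ → ℕ → ℕ)
    (h : ∀ A ∈ I, Tendsto
      (fun n => ({i | i < n * f n ∧ φ n i ∈ A}.ncard : ℝ) / f n) atTop (𝓝 0)) :
    KatLE I (PhiIdeal f) := by
  obtain ⟨F, hF⟩ := exists_glue_blocks f φ
  refine ⟨F, fun A hA => mem_PhiIdeal_of_tendsto ((h A hA).congr fun n => ?_)⟩
  have : F ⁻¹' A ∩ Set.Ico (PhiStart f n) (PhiStart f (n + 1)) =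
      (fun i => PhiStart f n + i) '' {i | i < n * f n ∧ φ n i ∈ A} := by
    ext x
    simp only [Set.mem_inter_iff, Set.mem_preimage, Set.mem_Ico, PhiStart_succ, Set.mem_image,
      Set.mem_ofPred_eq]
    constructor
    · rintro ⟨hx, h1, h2⟩
      obtain ⟨i, rfl⟩ := Nat.exists_eq_add_of_le h1
      have hi : i < n * f n := by omega
      exact ⟨i, ⟨hi, by rwa [← hF n i hi]⟩, rfl⟩
    · rintro ⟨i, ⟨hi, hiA⟩, rfl⟩
      exact ⟨by rwa [hF n i hi], by omega, by omega⟩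
  rw [this, Set.ncard_image_of_injective _ (add_right_injective _)]

lemma card_filter_mod_eq_le (N r v : ℕ) :
    ((Finset.range N).filter fun i => i % r = v).card ≤ N / r + 1 := by
  rw [← Finset.card_range (N / r + 1)]
  refine Finset.card_le_card_of_injOn (fun i => i / r) ?_ ?_
  · intro i hi
    simp only [Finset.coe_filter, Finset.mem_range, Set.mem_ofPred_eq] at hi
    simpa [Nat.lt_succ_iff] using Nat.div_le_div_right hi.1.le
  · intro i hi j hj hij
    simp only [Finset.coe_filter, Finset.mem_range, Set.mem_ofPred_eq] at hi hj
    rw [← Nat.div_add_mod i r, ← Nat.div_add_mod j r, hi.2, hj.2]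
    simp only at hij
    rw [hij]

lemma katLE_PhiIdeal_of_eventually_le {g h : ℕ → ℕ} (hg : ∀ n, 1 ≤ n → 0 < g n)
    (hgh : ∀ᶠ n in atTop, g n ≤ h n) : KatLE (PhiIdeal g) (PhiIdeal h) := by
  classical
  refine katLE_PhiIdeal (fun n i => PhiStart g n + i % (n * g n)) fun A hA => ?_
  have hlim := (tendsto_of_mem_PhiIdeal hg hA).const_mul 2
  rw [mul_zero] at hlim
  refine squeeze_zero' (Eventually.of_forall fun n => by positivity) ?_ hlim
  filter_upwards [hgh, eventually_ge_atTop 1] with n hn hn1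
  have hgn := hg n hn1
  have hr : 0 < n * g n := Nat.mul_pos hn1 hgn
  have hcard : {i | i < n * h n ∧ PhiStart g n + i % (n * g n) ∈ A}.ncard ≤
      (h n / g n + 1) * (A ∩ Set.Ico (PhiStart g n) (PhiStart g (n + 1))).ncard := by
    have h1 : {i | i < n * h n ∧ PhiStart g n + i % (n * g n) ∈ A} =
        ((Finset.range (n * h n)).filter fun i => PhiStart g n + i % (n * g n) ∈ A :
          Finset ℕ) := by
      ext i; simp
    rw [h1, Set.ncard_coe_finset, Set.ncard_eq_toFinset_card _ (finite_inter_block g A n)]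
    refine Finset.card_le_mul_card_image_of_maps_to
      (f := fun i => PhiStart g n + i % (n * g n)) ?_ _ ?_
    · intro i hi
      have := Nat.mod_lt i hr
      simp only [Finset.mem_filter] at hi
      simpa [PhiStart_succ, this] using hi.2
    · intro b hb
      rw [← Nat.mul_div_mul_left (h n) (g n) hn1]
      refine le_trans (Finset.card_le_card ?_)
        (card_filter_mod_eq_le (n * h n) (n * g n) (b - PhiStart g n))
      intro i hi
      simp only [Finset.mem_filter] at hi ⊢
      exact ⟨hi.1.1, by omega⟩
  have hgR : (0 : ℝ) < g n := by exact_mod_cast hgn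
  have hghR : (g n : ℝ) ≤ h n := by exact_mod_cast hn
  have hhR : (0 : ℝ) < h n := hgR.trans_le hghR
  set c := (A ∩ Set.Ico (PhiStart g n) (PhiStart g (n + 1))).ncard
  have h2 : ((h n / g n + 1 : ℕ) : ℝ) ≤ 2 * (h n / g n) := by
    have h3 : ((h n / g n : ℕ) : ℝ) ≤ h n / g n := Nat.cast_div_le
    have h4 : (1 : ℝ) ≤ h n / g n := (one_le_div hgR).2 hghR
    push_cast
    linarith
  rw [div_le_iff₀ hhR]
  calc _ ≤ ((h n / g n + 1 : ℕ) : ℝ) * c := by exact_mod_cast hcard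
    _ ≤ 2 * (h n / g n) * c := by gcongr
    _ = 2 * (c / g n) * h n := by ring

/-- Points can be sent to the elements of a finite set with prescribed maximal multiplicities,
provided the multiplicities add up to the number of points. -/
lemma exists_map_card_le (S : Finset ℕ) (c : ℕ → ℕ) (N : ℕ) (hN : N ≤ ∑ x ∈ S, c x) :
    ∃ φ : ℕ → ℕ, ∀ A : Set ℕ, ({i | i < N ∧ φ i ∈ A}.ncard : ℝ) ≤
      ∑ x ∈ S, A.indicator (fun x => (c x : ℝ)) x := by
  classical
  let T : Finset (Σ _ : ℕ, ℕ) := S.sigma fun x => Finset.range (c x)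
  have hT : (Finset.range N).card ≤ T.card := by simpa [T] using hN
  obtain ⟨U, hUT, hU⟩ := Finset.exists_subset_card_eq hT
  let e := Finset.equivOfCardEq hU.symm
  refine ⟨fun i => if hi : i ∈ Finset.range N then (e ⟨i, hi⟩).1.1 else 0, fun A => ?_⟩
  have h1 : ∑ x ∈ S, A.indicator (fun x => (c x : ℝ)) x =
      ((T.filter fun p => p.1 ∈ A).card : ℝ) := by
    have : T.filter (fun p => p.1 ∈ A) =
        (S.filter (· ∈ A)).sigma fun x => Finset.range (c x) := by
      ext p
      simp only [T, Finset.mem_filter, Finset.mem_sigma]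
      tauto
    rw [this, Finset.card_sigma, Finset.sum_filter]
    simp [Set.indicator]
  rw [h1]
  norm_cast
  rw [← Set.ncard_coe_finset]
  refine Set.ncard_le_ncard_of_injOn
    (fun i => if hi : i ∈ Finset.range N then (e ⟨i, hi⟩).1 else ⟨0, 0⟩) ?_ ?_
    (Finset.finite_toSet _)
  · rintro i ⟨hi, hiA⟩
    have hi' : i ∈ Finset.range N := Finset.mem_range.2 hi
    simp only [hi', dite_true] at hiA
    simp only [hi', dite_true, Finset.coe_filter, Set.mem_ofPred_eq]
    exact ⟨hUT (e ⟨i, hi'⟩).2, hiA⟩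
  · rintro i ⟨hi, -⟩ j ⟨hj, -⟩ hij
    have hi' : i ∈ Finset.range N := Finset.mem_range.2 hi
    have hj' : j ∈ Finset.range N := Finset.mem_range.2 hj
    simp only [hi', hj', dite_true] at hij
    simpa using e.injective (Subtype.ext hij)

/-- If nonnegative measures have norms tending to infinity but vanish asymptotically on each
member of `I`, then `I` lies Katětov below some `Φ(f)`. -/
lemma exists_katLE_PhiIdeal_of_tendsto {I : Set (Set ℕ)} (ν : ℕ → (ℕ →₀ ℝ))
    (hν : Tendsto (fun n => ∑ x ∈ (ν n).support, |ν n x|) atTop atTop)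
    (hI : ∀ A ∈ I, Tendsto
      (fun n => ∑ x ∈ (ν n).support, A.indicator (fun x => |ν n x|) x) atTop (𝓝 0)) :
    ∃ f : ℕ → ℕ, (∀ n, 1 ≤ n → 0 < f n) ∧ KatLE I (PhiIdeal f) := by
  have hk (n : ℕ) : ∃ k, n ≤ k ∧ (n : ℝ) + 1 ≤ ∑ x ∈ (ν k).support, |ν k x| :=
    ((eventually_ge_atTop n).and (hν.eventually_ge_atTop _)).exists
  choose k hk hkν using hk
  let f (n : ℕ) : ℕ := (ν (k n)).support.card + 1
  have hsum (n : ℕ) : n * f n ≤ ∑ x ∈ (ν (k n)).support, ⌊|ν (k n) x| * f n⌋₊ := by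
    have h1 : ∑ x ∈ (ν (k n)).support, (|ν (k n) x| * f n - 1) ≤
        ∑ x ∈ (ν (k n)).support, (⌊|ν (k n) x| * f n⌋₊ : ℝ) :=
      Finset.sum_le_sum fun x _ => (Nat.sub_one_lt_floor _).le
    rw [Finset.sum_sub_distrib, ← Finset.sum_mul] at h1
    have h2 : ((n : ℝ) + 1) * f n ≤ (∑ x ∈ (ν (k n)).support, |ν (k n) x|) * f n := by
      gcongr
      exact hkν n
    have h3 : (f n : ℝ) = (ν (k n)).support.card + 1 := by simp [f]
    simp only [Finset.sum_const, nsmul_eq_mul, mul_one] at h1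
    have h4 : (n : ℝ) * f n ≤ ∑ x ∈ (ν (k n)).support, (⌊|ν (k n) x| * f n⌋₊ : ℝ) := by
      linarith
    exact_mod_cast h4
  choose φ hφ using fun n => exists_map_card_le _ _ _ (hsum n)
  refine ⟨f, fun n _ => Nat.succ_pos _, katLE_PhiIdeal φ fun A hA => ?_⟩
  have hk' : Tendsto k atTop atTop := tendsto_atTop_mono hk tendsto_id
  refine squeeze_zero (fun n => by positivity) (fun n => ?_) ((hI A hA).comp hk')
  have hf : (0 : ℝ) < f n := by exact_mod_cast Nat.succ_pos _
  rw [div_le_iff₀ hf]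
  refine (hφ n A).trans ?_
  simp only [Function.comp, Finset.sum_mul]
  refine Finset.sum_le_sum fun x _ => ?_
  by_cases hx : x ∈ A
  · simpa [hx] using Nat.floor_le (by positivity)
  · simp [hx]

lemma isClopen_image_some {I : Set (Set ℕ)} {A : Set ℕ} (hA : A ∈ I) :
    @IsClopen _ (NFTop (dualFilter I)) (some '' A) := by
  let := NFTop (dualFilter I)
  refine ⟨⟨fun _ => ?_⟩, fun h => by simp at h⟩
  refine Filter.mem_of_superset (Filter.mem_generate_of_mem (U := Aᶜ) ?_) fun n hn => ?_
  · simpa using hA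
  · simpa using hn

lemma fsMeas_eq_some (μ : Option ℕ →₀ ℝ) (A : Set (Option ℕ)) :
    fsMeas μ A = A.indicator μ none +
      ∑ x ∈ μ.some.support, (some ⁻¹' A).indicator μ.some x := by
  classical
  have := Finsupp.sum_option_index μ (fun x r => if x ∈ A then r else 0) (by simp)
    (by intros; split_ifs <;> simp)
  simpa [Finsupp.sum, fsMeas, Set.indicator] using this

lemma fsNorm_le_some (μ : Option ℕ →₀ ℝ) :
    fsNorm μ ≤ |μ none| + ∑ x ∈ μ.some.support, |μ.some x| := by
  classical
  have h1 : μ.support ⊆ insert none (μ.some.support.map Function.Embedding.some) := by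
    intro x hx
    cases x with
    | none => simp
    | some y => simpa using hx
  refine (Finset.sum_le_sum_of_subset_of_nonneg h1 fun _ _ _ => abs_nonneg _).trans_eq ?_
  rw [Finset.sum_insert (by simp), Finset.sum_map]
  simp

/-- The parts on `ℕ` of the measures in an anti-Nikodym sequence still have norms tending to
infinity. -/
lemma IsANSeq.tendsto_sum_abs_some {F : Filter ℕ} {μ : ℕ → (Option ℕ →₀ ℝ)}
    (hμ : IsANSeq F μ) :
    Tendsto (fun n => ∑ x ∈ (μ n).some.support, |(μ n).some x|) atTop atTop := by
  let := NFTop F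
  have huniv := hμ.2 univ isClopen_univ
  have hev : ∀ᶠ n in atTop, |fsMeas (μ n) univ| < 1 := by
    simpa using huniv.abs.eventually (gt_mem_nhds (by simp : |(0 : ℝ)| < 1))
  have hlim : Tendsto (fun n => (fsNorm (μ n) - 1) / 2) atTop atTop :=
    (tendsto_atTop_add_const_right _ (-1) hμ.1).atTop_div_const two_pos
  refine tendsto_atTop_mono' _ ?_ hlim
  filter_upwards [hev] with n hn
  have h1 := fsNorm_le_some (μ n)
  rw [fsMeas_eq_some] at hn
  simp only [Set.indicator_univ, Set.preimage_univ] at hn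
  have h2 := Finset.abs_sum_le_sum_abs (fun x => (μ n).some x) (μ n).some.support
  have h3 := abs_sub_abs_le_abs_sub (μ n none) (-∑ x ∈ (μ n).some.support, (μ n).some x)
  rw [sub_neg_eq_add, abs_neg] at h3
  linarith

lemma IsANSeq.tendsto_sum_indicator_abs_some {I : Set (Set ℕ)}
    (hI : ∀ A B : Set ℕ, A ⊆ B → B ∈ I → A ∈ I) {μ : ℕ → (Option ℕ →₀ ℝ)}
    (hμ : IsANSeq (dualFilter I) μ) {A : Set ℕ} (hA : A ∈ I) :
    Tendsto (fun n => ∑ x ∈ (μ n).some.support, A.indicator (fun x => |(μ n).some x|) x)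
      atTop (𝓝 0) := by
  classical
  have key := tendsto_sum_abs_of_tendsto_sum_indicator
    (fun n => (μ n).some.filter (· ∈ A)) fun B => ?_
  · refine key.congr fun n => ?_
    rw [Finsupp.support_filter, Finset.sum_filter]
    refine Finset.sum_congr rfl fun x _ => ?_
    by_cases hx : x ∈ A <;> simp [hx]
  · refine (hμ.2 _ (isClopen_image_some (hI (A ∩ B) A Set.inter_subset_left hA))).congr
      fun n => ?_
    rw [fsMeas_eq_some, Set.preimage_image_eq _ (Option.some_injective _),
      Set.indicator_of_notMem (by simp), zero_add, Finsupp.support_filter, Finset.sum_filter]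
    refine Finset.sum_congr rfl fun x _ => ?_
    by_cases hx : x ∈ A <;> by_cases hB : x ∈ B <;> simp [hx, hB]

/-- Theorem `thm_katetov`. For the operator `Φ` sending `f` to the density
ideal `Φ(f) = Exh(sup_{n≥1} μ_n^f)` (where `μ_n^f` puts mass `1/f(n)` on each point of the
`n`-th interval `I_n` of length `n·f(n)`):
(1) every `I ∈ AN` satisfies `I ≤_K Φ(f)` for some `f`; and
(2) if `2n²·g(n) ≤ h(n)` for all but finitely many `n`, then `Φ(g) ≤_K Φ(h)`. -/
theorem Phi_operator_properties :
    (∀ I ∈ ANclass, ∃ f : ℕ → ℕ, (∀ n, 1 ≤ n → 0 < f n) ∧ KatLE I (PhiIdeal f)) ∧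
    (∀ g h : ℕ → ℕ, (∀ n, 1 ≤ n → 0 < g n) → (∀ n, 1 ≤ n → 0 < h n) →
      (∀ᶠ n in atTop, 2 * n ^ 2 * g n ≤ h n) → KatLE (PhiIdeal g) (PhiIdeal h)) := by
  refine ⟨?_, fun g h hg _ hgh => ?_⟩
  · rintro I ⟨hI, hN⟩
    obtain ⟨μ, hμ⟩ := not_not.1 hN
    exact exists_katLE_PhiIdeal_of_tendsto (fun n => (μ n).some) hμ.tendsto_sum_abs_some
      fun A hA => hμ.tendsto_sum_indicator_abs_some hI.2.1 hA
  · refine katLE_PhiIdeal_of_eventually_le hg ?_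
    filter_upwards [hgh, eventually_ge_atTop 1] with n hn hn1
    exact (Nat.le_mul_of_pos_left _ (by positivity)).trans hn
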